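/- Let s be a weak composition and T an s-decreasing tree with tree ascents (a,b) and (c,d), a < c, and let Z and Q be the s-tree rotations of T along (a,b) and (c,d). Suppose (a,b) is a tree ascent of Q and (c,d) is a tree ascent of Z. Then the closed interval [T, Z ∨ Q] in s-weak order consists exactly of the four elements T, Z, Q, Z ∨ Q with Z, Q ⋖ Z ∨ Q (its Hasse diagram is a diamond), and its two maximal chains T ⋖ Z ⋖ Z ∨ Q and T ⋖ Q ⋖ Z ∨ Q have label sequences (a, c) and (c, a) under the labeling λ that assigns to each cover relation the smaller element of its associated tree ascent. -/

import Mathlib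

open scoped Classical

/-- An `s`-decreasing tree with internal vertices `1,…,n` (the root is `n`), encoded by
recording, for each non-root internal vertex `v`, its parent `parent v` (an internal vertex
with a larger label, so that labels decrease away from the root) and the index `idx v` of
the child slot of `parent v` (among `0,…,s (parent v)`, left to right) containing `v`.
Distinct internal vertices occupy distinct child slots; all remaining slots are leaves. -/
structure SDecTree (n : ℕ) (s : ℕ → ℕ) where
  parent : ℕ → ℕ
  idx : ℕ → ℕ
  parent_gt : ∀ v, 1 ≤ v → v < n → v < parent v
  parent_le : ∀ v, 1 ≤ v → v < n → parent v ≤ n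
  idx_le : ∀ v, 1 ≤ v → v < n → idx v ≤ s (parent v)
  slot_inj : ∀ v w, 1 ≤ v → v < n → 1 ≤ w → w < n →
      parent v = parent w → idx v = idx w → v = w
  parent_out : ∀ v, v = 0 ∨ n ≤ v → parent v = 0
  idx_out : ∀ v, v = 0 ∨ n ≤ v → idx v = 0

namespace SDecTree

variable {n : ℕ} {s : ℕ → ℕ}

/-- `y` is a weak ancestor of `x`, i.e. `x` is a labeled vertex of the subtree `T^y`. -/
def Descend (T : SDecTree n s) (x y : ℕ) : Prop :=
  ∃ k, T.parent^[k] x = y ∧ ∀ m ≤ k, 1 ≤ T.parent^[m] x ∧ T.parent^[m] x ≤ n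

/-- `x` is a labeled vertex of the subtree `T^y_j` rooted at the `j`-th child of `y`. -/
def InSub (T : SDecTree n s) (y j x : ℕ) : Prop :=
  ∃ c, T.Descend x c ∧ T.parent c = y ∧ T.idx c = j

/-- `x` lies strictly left of `y` in the planar tree `T`. -/
def LeftOf (T : SDecTree n s) (x y : ℕ) : Prop :=
  ∃ z j₁ j₂, j₁ < j₂ ∧ T.InSub z j₁ x ∧ T.InSub z j₂ y

/-- The cardinality `#_T(y,x)` of the pair `(y,x)`: it is `j` if `x ∈ T^y_j`
(so `0` if `x ∈ T^y_0` and `s y` if `x ∈ T^y_{s y}`), `0` if `x` is left of `y`, and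
`s y` if `x` is right of `y`; it is `0` for out-of-range pairs. -/
noncomputable def card (T : SDecTree n s) (y x : ℕ) : ℕ :=
  if h : ∃ j, T.InSub y j x then h.choose
  else if 1 ≤ x ∧ x < y ∧ y ≤ n ∧ ¬ T.LeftOf x y then s y else 0

/-- `x` is a labeled vertex of `T^a ∖ 0`, i.e. of `T^a` with `T^a_0` replaced by a leaf. -/
def InSubMinus0 (T : SDecTree n s) (a x : ℕ) : Prop :=
  x = a ∨ ∃ j, 0 < j ∧ T.InSub a j x

/-- `(a,b)` is a tree ascent of `T`. -/
def TreeAscent (T : SDecTree n s) (a b : ℕ) : Prop :=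
  1 ≤ a ∧ a < b ∧ b ≤ n ∧
  (∃ i, i < s b ∧ T.InSub b i a) ∧
  (∀ e j, a < e → e < b → T.InSub e j a → j = s e) ∧
  (0 < s a → ∀ x, ¬ T.InSub a (s a) x)

end SDecTree

/-- A multi-inversion set (encoded by its multiplicity function) is transitive:
if `a < b < c` then `#(b,a) = 0` or `#(c,a) ≥ #(c,b)`. -/
def IsTransitiveInv (I : ℕ → ℕ → ℕ) : Prop :=
  ∀ a b c, a < b → b < c → I b a = 0 ∨ I c b ≤ I c a

/-- The transitive closure of a multi-inversion set: the smallest (by inclusion, i.e.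
pointwise on multiplicities) transitive multi-inversion set containing it. -/
noncomputable def tcInv (I : ℕ → ℕ → ℕ) : ℕ → ℕ → ℕ := fun y x =>
  sInf {m | ∃ J : ℕ → ℕ → ℕ, IsTransitiveInv J ∧ (∀ y' x', I y' x' ≤ J y' x') ∧ J y x = m}

/-- Add one copy of the inversion `(b,a)` to `I`, capping the multiplicity at `s b`. -/
def addInv (s : ℕ → ℕ) (I : ℕ → ℕ → ℕ) (b a : ℕ) : ℕ → ℕ → ℕ := fun y x =>
  if y = b ∧ x = a then min (I y x + 1) (s y) else I y x

namespace SDecTree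

variable {n : ℕ} {s : ℕ → ℕ}

/-- The `s`-weak order: `T ⪯ Z` iff `#_T(y,x) ≤ #_Z(y,x)` for all pairs. -/
def wle (T Z : SDecTree n s) : Prop := ∀ y x, T.card y x ≤ Z.card y x

/-- Strict `s`-weak order. -/
def wlt (T Z : SDecTree n s) : Prop := wle T Z ∧ ¬ wle Z T

/-- Cover relation in the `s`-weak order. -/
def wcov (T Z : SDecTree n s) : Prop := wlt T Z ∧ ∀ U, wlt T U → wlt U Z → False

/-- `W` is the join of `T` and `Z` in the `s`-weak order. -/
def IsJoin (T Z W : SDecTree n s) : Prop :=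
  wle T W ∧ wle Z W ∧ ∀ U, wle T U → wle Z U → wle W U

/-- `Z` is the `s`-tree rotation of `T` along the tree ascent `(a,b)`, i.e.
`inv Z = (inv T + (b,a))^tc`. -/
def IsRotation (T Z : SDecTree n s) (a b : ℕ) : Prop :=
  T.TreeAscent a b ∧
  ∀ y x, 1 ≤ x → x < y → y ≤ n → Z.card y x = tcInv (addInv s T.card b a) y x

/-- The set `A_T(a,b)` of inversions added by a rotation producing `Z`: the pairs `(f,e)`
with `#_Z(f,e) > #_T(f,e)`. -/
def Aset (T Z : SDecTree n s) : Set (ℕ × ℕ) :=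
  {p | T.card p.1 p.2 < Z.card p.1 p.2}

/-- The set `A_T(a,b)` described directly via the transitive closure. -/
def ARot (T : SDecTree n s) (a b : ℕ) : Set (ℕ × ℕ) :=
  {p | T.card p.1 p.2 < tcInv (addInv s T.card b a) p.1 p.2}

/-- The set `F_T(a,c)` (here `b` and `d` are the partners of `a` and `c` in the
respective tree ascents `(a,b)` and `(c,d)`): it is `{(d,e) : e ∈ T^a∖0}` if `b = c`
and `a ∈ T^c_0`, and empty otherwise. -/
def Fset (T : SDecTree n s) (a b c d : ℕ) : Set (ℕ × ℕ) :=
  {p | b = c ∧ T.InSub c 0 a ∧ p.1 = d ∧ T.InSubMinus0 a p.2}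

/-- `T` is an `s`-Tamari tree: `#_T(c,a) ≤ #_T(c,b)` whenever `a < b < c`. -/
def IsTamari (T : SDecTree n s) : Prop :=
  ∀ a b c, a < b → b < c → T.card c a ≤ T.card c b

/-- `(a,b)` is a Tamari tree ascent of `T`: `a` is a non-rightmost child of `b`. -/
def TamariAscent (T : SDecTree n s) (a b : ℕ) : Prop :=
  1 ≤ a ∧ a < n ∧ T.parent a = b ∧ T.card b a < s b

/-- `Z` is the `s`-Tamari rotation of `T` along the Tamari tree ascent `(a,b)`. -/
def IsTamRotation (T Z : SDecTree n s) (a b : ℕ) : Prop :=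
  T.TamariAscent a b ∧
  ∀ y x, 1 ≤ x → x < y → y ≤ n → Z.card y x = tcInv (addInv s T.card b a) y x

/-- Cover relation in the `s`-Tamari lattice. -/
def tamcov (T Z : SDecTree n s) : Prop :=
  IsTamari T ∧ IsTamari Z ∧ wlt T Z ∧ ∀ U, IsTamari U → wlt T U → wlt U Z → False

/-- `W` is the join of `T` and `Z` in the `s`-Tamari lattice. -/
def IsTamJoin (T Z W : SDecTree n s) : Prop :=
  IsTamari W ∧ wle T W ∧ wle Z W ∧ ∀ U, IsTamari U → wle T U → wle Z U → wle W U

/-- The open interval `(T,Z)` in the `s`-weak order. -/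
def OpenInterval (T Z : SDecTree n s) : Set (SDecTree n s) := {U | wlt T U ∧ wlt U Z}

/-- A set of trees forming a chain in the `s`-weak order. -/
def IsChainSet (C : Set (SDecTree n s)) : Prop :=
  C.Pairwise fun U V => wlt U V ∨ wlt V U

/-- The geometric realization of the order complex `Δ(T,Z)` of the open interval `(T,Z)`
in the `s`-weak order: the space of finitely supported probability vectors on the vertex
set whose support is a chain of the open interval. -/
def orderComplex (T Z : SDecTree n s) : Set (SDecTree n s → ℝ) :=
  {f | (∀ U, 0 ≤ f U) ∧ (Function.support f).Finite ∧
    Function.support f ⊆ OpenInterval T Z ∧ IsChainSet (Function.support f) ∧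
    ∑ᶠ U, f U = 1}

/-- The geometric realization of the order complex of the open interval `(T,Z)` in the
`s`-Tamari lattice. -/
def tamOrderComplex (T Z : SDecTree n s) : Set (SDecTree n s → ℝ) :=
  {f | (∀ U, 0 ≤ f U) ∧ (Function.support f).Finite ∧
    Function.support f ⊆ {U | IsTamari U ∧ wlt T U ∧ wlt U Z} ∧
    IsChainSet (Function.support f) ∧ ∑ᶠ U, f U = 1}

end SDecTree

/-- The list of labels of the consecutive cover relations along a saturated chain,
recorded as a list of poset elements. -/
def labelsOf {α : Type*} (lab : α → α → ℕ) (L : List α) : List ℕ :=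
  (L.zip L.tail).map fun p => lab p.1 p.2

namespace SDecTree

variable {n : ℕ} {s : ℕ → ℕ}

lemma Descend.range {T : SDecTree n s} {x y : ℕ} (h : T.Descend x y) :
    1 ≤ x ∧ x ≤ n ∧ 1 ≤ y ∧ y ≤ n := by
  obtain ⟨k, hk, hm⟩ := h
  have h0 := hm 0 (Nat.zero_le _)
  have h1 := hm k le_rfl
  rw [hk] at h1
  exact ⟨h0.1, h0.2, h1.1, h1.2⟩

lemma descend_refl (T : SDecTree n s) {x : ℕ} (h1 : 1 ≤ x) (h2 : x ≤ n) : T.Descend x x :=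
  ⟨0, rfl, fun m hm => by
    have : m = 0 := by omega
    subst this; exact ⟨h1, h2⟩⟩

lemma Descend.trans {T : SDecTree n s} {x y z : ℕ} (h : T.Descend x y) (h' : T.Descend y z) :
    T.Descend x z := by
  obtain ⟨k, hk, hm⟩ := h
  obtain ⟨l, hl, hm'⟩ := h'
  refine ⟨l + k, by rw [Function.iterate_add_apply, hk, hl], fun m hml => ?_⟩
  by_cases hmk : m ≤ k
  · exact hm m hmk
  · have : m = (m - k) + k := by omega
    rw [this, Function.iterate_add_apply, hk]
    exact hm' _ (by omega)

lemma descend_parent (T : SDecTree n s) {x : ℕ} (h1 : 1 ≤ x) (h2 : x < n) :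
    T.Descend x (T.parent x) := by
  refine ⟨1, rfl, fun m hm => ?_⟩
  have h3 := T.parent_gt x h1 h2
  have h4 := T.parent_le x h1 h2
  rcases (by omega : m = 0 ∨ m = 1) with rfl | rfl
  · exact ⟨h1, h2.le⟩
  · exact ⟨by simp; omega, by simpa using h4⟩

lemma lt_n_of_parent (T : SDecTree n s) {c : ℕ} (h : 1 ≤ T.parent c) : 1 ≤ c ∧ c < n := by
  by_contra hc
  have := T.parent_out c (by omega)
  omega

lemma Descend.cases_head {T : SDecTree n s} {x y : ℕ} (h : T.Descend x y) :
    x = y ∨ (x < n ∧ T.Descend (T.parent x) y) := by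
  obtain ⟨k, hk, hm⟩ := h
  rcases k with _ | k
  · exact Or.inl hk
  · right
    have h1 := hm 1 (by omega)
    simp only [Function.iterate_one] at h1
    refine ⟨(T.lt_n_of_parent h1.1).2, k, by simpa using hk, fun m hmk => ?_⟩
    have := hm (m + 1) (by omega)
    simpa using this

lemma Descend.le {T : SDecTree n s} {x y : ℕ} (h : T.Descend x y) : x ≤ y := by
  obtain ⟨k, hk⟩ : ∃ k, k = n - x := ⟨_, rfl⟩
  induction k using Nat.strong_induction_on generalizing x with
  | _ k ih =>
    rcases h.cases_head with rfl | ⟨h1, h2⟩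
    · exact le_rfl
    · have h3 := T.parent_gt x h.range.1 h1
      have := ih (n - T.parent x) (by omega) h2 rfl
      omega

/-- Ancestors of a vertex form a chain. -/
lemma Descend.chain {T : SDecTree n s} {x y z : ℕ} (h : T.Descend x y) (h' : T.Descend x z)
    (hyz : y ≤ z) : T.Descend y z := by
  obtain ⟨k, hk⟩ : ∃ k, k = n - x := ⟨_, rfl⟩
  induction k using Nat.strong_induction_on generalizing x with
  | _ k ih =>
    rcases h.cases_head with rfl | ⟨h1, h2⟩
    · exact h'
    · have h3 := T.parent_gt x h.range.1 h1
      rcases h'.cases_head with rfl | ⟨h4, h5⟩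
      · have := h2.le
        omega
      · exact ih (n - T.parent x) (by omega) h2 h5 rfl

lemma descend_root (T : SDecTree n s) {x : ℕ} (h1 : 1 ≤ x) (h2 : x ≤ n) : T.Descend x n := by
  obtain ⟨k, hk⟩ : ∃ k, k = n - x := ⟨_, rfl⟩
  induction k using Nat.strong_induction_on generalizing x with
  | _ k ih =>
    by_cases hx : x = n
    · subst hx; exact T.descend_refl h1 h2
    · have h3 := T.parent_gt x h1 (by omega)
      have h4 := T.parent_le x h1 (by omega)
      exact (T.descend_parent h1 (by omega)).trans (ih (n - T.parent x) (by omega) (by omega) h4 rfl)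

/-- Going up to a strict ancestor passes through a child of it. -/
lemma Descend.exists_inSub {T : SDecTree n s} {x y : ℕ} (h : T.Descend x y) (hxy : x < y) :
    ∃ j, T.InSub y j x := by
  obtain ⟨k, hk⟩ : ∃ k, k = n - x := ⟨_, rfl⟩
  induction k using Nat.strong_induction_on generalizing x with
  | _ k ih =>
    rcases h.cases_head with rfl | ⟨h1, h2⟩
    · omega
    · have h3 := T.parent_gt x h.range.1 h1
      by_cases hp : T.parent x = y
      · exact ⟨T.idx x, x, T.descend_refl h.range.1 h1.le, hp, rfl⟩
      · have h4 := h2.le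
        obtain ⟨j, c, hc, hc'⟩ := ih (n - T.parent x) (by omega) h2 (by omega) rfl
        exact ⟨j, c, (T.descend_parent h.range.1 h1).trans hc, hc'⟩

lemma InSub.descend {T : SDecTree n s} {y j x : ℕ} (h : T.InSub y j x) (hy : 1 ≤ y) :
    T.Descend x y ∧ x < y := by
  obtain ⟨c, h1, rfl, h3⟩ := h
  obtain ⟨h4, h5⟩ := T.lt_n_of_parent hy
  have := T.parent_gt c h4 h5
  have := h1.le
  exact ⟨h1.trans (T.descend_parent h4 h5), by omega⟩

lemma InSub.unique {T : SDecTree n s} {y j j' x : ℕ} (h : T.InSub y j x) (h' : T.InSub y j' x) :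
    j = j' := by
  obtain ⟨c, h1, h2, h3⟩ := h
  obtain ⟨c', h1', h2', h3'⟩ := h'
  have key : c = c' := by
    have aux : ∀ u v, T.Descend x u → T.Descend x v → T.parent u = y → T.parent v = y →
        u ≤ v → u = v := by
      intro u v hu hv hpu hpv huv
      rcases (hu.chain hv huv).cases_head with h | ⟨h4, h5⟩
      · exact h
      · rw [hpu] at h5
        have h6 := h5.le
        have h7 := h5.range
        rw [← hpv] at h7
        obtain ⟨h8, h9⟩ := T.lt_n_of_parent h7.1
        have := T.parent_gt v h8 h9
        omega
    rcases le_total c c' with hc | hc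
    · exact aux c c' h1 h1' h2 h2' hc
    · exact (aux c' c h1' h1 h2' h2 hc).symm
  subst key
  omega

lemma InSub.le_s {T : SDecTree n s} {y j x : ℕ} (h : T.InSub y j x) (hy : 1 ≤ y) : j ≤ s y := by
  obtain ⟨c, h1, rfl, rfl⟩ := h
  obtain ⟨h4, h5⟩ := T.lt_n_of_parent hy
  exact T.idx_le c h4 h5

lemma InSub.of_descend {T : SDecTree n s} {y j x x' : ℕ} (h : T.InSub y j x)
    (hd : T.Descend x' x) : T.InSub y j x' := by
  obtain ⟨c, h1, h2⟩ := h
  exact ⟨c, hd.trans h1, h2⟩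

/-- A vertex between `x` and `y` on the path is in the same slot. -/
lemma InSub.up {T : SDecTree n s} {y j x x' : ℕ} (h : T.InSub y j x) (hd : T.Descend x x')
    (hy : x' < y) : T.InSub y j x' := by
  have h1 := h.descend (by omega)
  obtain ⟨j', hj'⟩ := (hd.chain h1.1 hy.le).exists_inSub hy
  have := (hj'.of_descend hd).unique h
  exact this ▸ hj'

lemma LeftOf.data {T : SDecTree n s} {x y : ℕ} (h : T.LeftOf x y) :
    ∃ z j₁ j₂, j₁ < j₂ ∧ T.InSub z j₁ x ∧ T.InSub z j₂ y ∧ 1 ≤ z ∧ x < z ∧ y < z := by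
  obtain ⟨z, j₁, j₂, hj, h1, h2⟩ := h
  have hz : 1 ≤ z := by
    by_contra hz
    have hz : z = 0 := by omega
    subst hz
    have : ∀ j u, T.InSub 0 j u → j = 0 := by
      rintro j u ⟨c, hc, hc', rfl⟩
      apply T.idx_out
      by_contra hcn
      have := T.parent_gt c (by omega) (by omega)
      omega
    rw [this _ _ h1, this _ _ h2] at hj
    omega
  exact ⟨z, j₁, j₂, hj, h1, h2, hz, (h1.descend hz).2, (h2.descend hz).2⟩

lemma LeftOf.trans {T : SDecTree n s} {x y u : ℕ} (h : T.LeftOf x y) (h' : T.LeftOf y u) :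
    T.LeftOf x u := by
  obtain ⟨w, j1, j2, hj, h1, h2, hw, hxw, hyw⟩ := h.data
  obtain ⟨v, k1, k2, hk, g1, g2, hv, hyv, huv⟩ := h'.data
  have hd := (h2.descend hw).1
  have hd' := (g1.descend hv).1
  rcases lt_trichotomy w v with hlt | heq | hlt
  · exact ⟨v, k1, k2, hk, (g1.up hd hlt).of_descend (h1.descend hw).1, g2⟩
  · subst heq
    have := h2.unique g1
    exact ⟨w, j1, k2, by omega, h1, g2⟩
  · exact ⟨w, j1, j2, hj, h1, (h2.up hd' hlt).of_descend (g2.descend hv).1⟩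

lemma LeftOf.of_desc_left {T : SDecTree n s} {x y x' : ℕ} (h : T.LeftOf x y)
    (hd : T.Descend x' x) : T.LeftOf x' y := by
  obtain ⟨z, j₁, j₂, hj, h1, h2⟩ := h
  exact ⟨z, j₁, j₂, hj, h1.of_descend hd, h2⟩

lemma LeftOf.of_desc_right {T : SDecTree n s} {x y y' : ℕ} (h : T.LeftOf x y)
    (hd : T.Descend y' y) : T.LeftOf x y' := by
  obtain ⟨z, j₁, j₂, hj, h1, h2⟩ := h
  exact ⟨z, j₁, j₂, hj, h1, h2.of_descend hd⟩

lemma LeftOf.irrefl {T : SDecTree n s} {x : ℕ} (h : T.LeftOf x x) : False := by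
  obtain ⟨z, j₁, j₂, hj, h1, h2⟩ := h
  have := h1.unique h2
  omega

lemma LeftOf.not_desc {T : SDecTree n s} {x y : ℕ} (h : T.LeftOf x y) : ¬ T.Descend x y :=
  fun hd => (h.of_desc_right hd).irrefl

lemma LeftOf.not_desc' {T : SDecTree n s} {x y : ℕ} (h : T.LeftOf x y) : ¬ T.Descend y x :=
  fun hd => (h.of_desc_left hd).irrefl

lemma trichotomy (T : SDecTree n s) {x y : ℕ} (hx : 1 ≤ x) (hxy : x < y) (hy : y ≤ n) :
    T.Descend x y ∨ T.LeftOf x y ∨ T.LeftOf y x := by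
  have hex : ∃ w, T.Descend x w ∧ T.Descend y w :=
    ⟨n, T.descend_root hx (by omega), T.descend_root (by omega) hy⟩
  obtain ⟨h1, h2⟩ := Nat.find_spec hex
  have hmin := fun m => Nat.find_min hex (m := m)
  set w := Nat.find hex
  rcases Nat.lt_or_ge y w with hyw | hyw
  · obtain ⟨j1, c1, a1, a2, a3⟩ := h1.exists_inSub (by omega)
    obtain ⟨j2, c2, b1, b2, b3⟩ := h2.exists_inSub hyw
    rcases lt_trichotomy j1 j2 with hj | hj | hj
    · exact Or.inr (Or.inl ⟨w, j1, j2, hj, ⟨c1, a1, a2, a3⟩, ⟨c2, b1, b2, b3⟩⟩)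
    · exfalso
      obtain ⟨p1, p2⟩ := T.lt_n_of_parent (c := c1) (by omega)
      obtain ⟨q1, q2⟩ := T.lt_n_of_parent (c := c2) (by omega)
      have := T.slot_inj c1 c2 p1 p2 q1 q2 (by omega) (by omega)
      subst this
      have := T.parent_gt c1 p1 p2
      exact hmin c1 (by omega) ⟨a1, b1⟩
    · exact Or.inr (Or.inr ⟨w, j2, j1, hj, ⟨c2, b1, b2, b3⟩, ⟨c1, a1, a2, a3⟩⟩)
  · have := h2.le
    have : w = y := by omega
    rw [this] at h1
    exact Or.inl h1

lemma InSub.card_eq {T : SDecTree n s} {y j x : ℕ} (h : T.InSub y j x) : T.card y x = j := by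
  unfold card
  have hex : ∃ j, T.InSub y j x := ⟨j, h⟩
  rw [dif_pos hex]
  exact hex.choose_spec.unique h

lemma card_left {T : SDecTree n s} {y x : ℕ} (h : T.LeftOf x y) : T.card y x = 0 := by
  unfold card
  have hy : 1 ≤ y := by
    obtain ⟨z, j₁, j₂, hj, h1, ⟨c, hc, _⟩⟩ := h
    exact hc.range.1
  rw [dif_neg, if_neg]
  · tauto
  · rintro ⟨j, hj⟩
    exact h.not_desc (hj.descend hy).1

lemma card_right {T : SDecTree n s} {y x : ℕ} (h : T.LeftOf y x) (hxy : x < y) :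
    T.card y x = s y := by
  unfold card
  have hy : (1 ≤ y ∧ y ≤ n) ∧ 1 ≤ x := by
    obtain ⟨z, j₁, j₂, hj, ⟨c', hc', _⟩, ⟨c, hc, _⟩⟩ := h
    exact ⟨⟨hc'.range.1, hc'.range.2.1⟩, hc.range.1⟩
  rw [dif_neg, if_pos]
  · exact ⟨hy.2, hxy, hy.1.2, fun h' => (h.trans h').irrefl⟩
  · rintro ⟨j, hj⟩
    exact h.not_desc' (hj.descend hy.1.1).1

lemma card_out (T : SDecTree n s) {y x : ℕ} (h : ¬ (1 ≤ x ∧ x < y ∧ y ≤ n)) :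
    T.card y x = 0 := by
  unfold card
  split_ifs with h1 h2
  · have h3 := h1.choose_spec
    set j := h1.choose
    by_cases hy : 1 ≤ y
    · have h4 := h3.descend hy
      have := h4.1.range
      omega
    · obtain ⟨c, hc, hc', h5⟩ := h3
      rw [← h5]
      apply T.idx_out
      by_contra hcn
      have := T.parent_gt c (by omega) (by omega)
      omega
  · tauto
  · rfl

lemma card_le (T : SDecTree n s) (y x : ℕ) : T.card y x ≤ s y := by
  by_cases h : 1 ≤ x ∧ x < y ∧ y ≤ n
  · rcases T.trichotomy h.1 h.2.1 h.2.2 with h1 | h1 | h1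
    · obtain ⟨j, hj⟩ := h1.exists_inSub h.2.1
      rw [hj.card_eq]; exact hj.le_s (by omega)
    · rw [card_left h1]; omega
    · rw [card_right h1 h.2.1]
  · rw [T.card_out h]; omega

lemma inSub_of_card {T : SDecTree n s} {y x : ℕ} (h : 0 < T.card y x) (h' : T.card y x < s y) :
    T.InSub y (T.card y x) x := by
  by_cases hr : 1 ≤ x ∧ x < y ∧ y ≤ n
  · rcases T.trichotomy hr.1 hr.2.1 hr.2.2 with h1 | h1 | h1
    · obtain ⟨j, hj⟩ := h1.exists_inSub hr.2.1
      rwa [hj.card_eq]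
    · rw [card_left h1] at h; omega
    · rw [card_right h1 hr.2.1] at h'; omega
  · rw [T.card_out hr] at h; omega

lemma card_desc {T : SDecTree n s} {x y z : ℕ} (h : T.Descend x y) (hz : y < z) :
    T.card z x = T.card z y := by
  by_cases hzn : z ≤ n
  · have hr := h.range
    have hle := h.le
    rcases T.trichotomy hr.2.2.1 hz hzn with h1 | h1 | h1
    · obtain ⟨j, hj⟩ := h1.exists_inSub hz
      rw [hj.card_eq, (hj.of_descend h).card_eq]
    · rw [card_left h1, card_left (h1.of_desc_left h)]
    · rw [card_right h1 hz, card_right (h1.of_desc_right h) (by omega)]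
  · rw [T.card_out (by omega), T.card_out (by omega)]

lemma card_mono_left {T : SDecTree n s} {u v z : ℕ} (h : T.LeftOf u v) (hu : u < z) (hv : v < z) :
    T.card z u ≤ T.card z v := by
  by_cases hzn : z ≤ n
  · obtain ⟨w, j1, j2, hj, h1, h2, hw, huw, hvw⟩ := h.data
    have hd1 := (h1.descend hw).1
    have hd2 := (h2.descend hw).1
    rcases T.trichotomy hd1.range.1 hu hzn with g | g | g
    · rcases Nat.lt_or_ge z w with hlt | hge
      · have : T.LeftOf z v := ⟨w, j1, j2, hj, h1.up g hlt, h2⟩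
        rw [card_right this hv]
        exact T.card_le _ _
      · rcases Nat.eq_or_lt_of_le hge with heq | hlt
        · subst heq
          rw [h1.card_eq, h2.card_eq]; exact hj.le
        · rw [card_desc hd1 hlt, card_desc hd2 hlt]
    · rw [card_left g]; omega
    · rw [card_right (g.trans h) hv]
      exact T.card_le _ _
  · rw [T.card_out (by omega)]; omega

lemma card_trans (T : SDecTree n s) : IsTransitiveInv T.card := by
  intro x y z hxy hyz
  by_cases hr : 1 ≤ x ∧ z ≤ n
  · rcases T.trichotomy hr.1 hxy (by omega) with h1 | h1 | h1
    · right; rw [card_desc h1 hyz]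
    · left; exact card_left h1
    · right; exact card_mono_left h1 hyz (by omega)
  · by_cases hx : 1 ≤ x
    · right; rw [T.card_out (by omega)]; omega
    · left; rw [T.card_out (by omega)]

/-- Planarity. -/
lemma card_planar (T : SDecTree n s) {x y z : ℕ} (hx : 1 ≤ x) (hxy : x < y) (hyz : y < z) :
    T.card y x = s y ∨ T.card z x ≤ T.card z y := by
  by_cases hr : z ≤ n
  · rcases T.trichotomy hx hxy (by omega) with h1 | h1 | h1
    · right; rw [card_desc h1 hyz]
    · right; exact card_mono_left h1 (by omega) hyz
    · left; exact card_right h1 hxy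
  · right; rw [T.card_out (by omega)]; omega

lemma descend_iff (T : SDecTree n s) {x y : ℕ} (hx : 1 ≤ x) (hxy : x < y) (hy : y ≤ n) :
    T.Descend x y ↔ ∀ z, y < z → T.card z x = T.card z y := by
  refine ⟨fun h z hz => card_desc h hz, fun h => ?_⟩
  rcases T.trichotomy hx hxy hy with h1 | h1 | h1
  · exact h1
  · obtain ⟨w, j1, j2, hj, h1, h2, hw, huw, hvw⟩ := h1.data
    have := h w hvw
    rw [h1.card_eq, h2.card_eq] at this
    omega
  · obtain ⟨w, j1, j2, hj, h1, h2, hw, huw, hvw⟩ := h1.data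
    have := h w huw
    rw [h1.card_eq, h2.card_eq] at this
    omega

lemma parent_le_of_descend {T : SDecTree n s} {x y : ℕ} (h : T.Descend x y) (hxy : x < y) :
    T.parent x ≤ y := by
  rcases h.cases_head with h | ⟨_, h⟩
  · omega
  · exact h.le

lemma eq_of_card {T Z : SDecTree n s} (h : ∀ y x, T.card y x = Z.card y x) : T = Z := by
  have hD : ∀ x y, 1 ≤ x → x < y → y ≤ n → (T.Descend x y ↔ Z.Descend x y) := by
    intro x y hx hxy hy
    rw [T.descend_iff hx hxy hy, Z.descend_iff hx hxy hy]
    simp only [h]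
  have hp : ∀ x, 1 ≤ x → x < n → T.parent x = Z.parent x := by
    intro x hx hxn
    have a1 := T.parent_gt x hx hxn
    have a2 := Z.parent_gt x hx hxn
    have b1 := T.parent_le x hx hxn
    have b2 := Z.parent_le x hx hxn
    have c1 := parent_le_of_descend ((hD x _ hx a1 b1).1 (T.descend_parent hx hxn)) a1
    have c2 := parent_le_of_descend ((hD x _ hx a2 b2).2 (Z.descend_parent hx hxn)) a2
    omega
  have hi : ∀ x, 1 ≤ x → x < n → T.idx x = Z.idx x := by
    intro x hx hxn
    have e1 : T.InSub (T.parent x) (T.idx x) x := ⟨x, T.descend_refl hx hxn.le, rfl, rfl⟩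
    have e2 : Z.InSub (Z.parent x) (Z.idx x) x := ⟨x, Z.descend_refl hx hxn.le, rfl, rfl⟩
    rw [← e1.card_eq, ← e2.card_eq, h, hp x hx hxn]
  have hp' : T.parent = Z.parent := by
    funext x
    by_cases hx : 1 ≤ x ∧ x < n
    · exact hp x hx.1 hx.2
    · rw [T.parent_out x (by omega), Z.parent_out x (by omega)]
  have hi' : T.idx = Z.idx := by
    funext x
    by_cases hx : 1 ≤ x ∧ x < n
    · exact hi x hx.1 hx.2
    · rw [T.idx_out x (by omega), Z.idx_out x (by omega)]
  cases T; cases Z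
  simp only at hp' hi'
  subst hp' hi'
  rfl

lemma wle_antisymm {T Z : SDecTree n s} (h : wle T Z) (hrev : wle Z T) : T = Z :=
  eq_of_card fun y x => le_antisymm (h y x) (hrev y x)

/-- The descendant relation read off an inversion set. -/
def DRel (n : ℕ) (I : ℕ → ℕ → ℕ) (x y : ℕ) : Prop := ∀ z, y < z → z ≤ n → I z x = I z y

lemma exists_parent (n : ℕ) (I : ℕ → ℕ → ℕ) {v : ℕ} (hv : v < n) :
    ∃ y, v < y ∧ y ≤ n ∧ DRel n I v y := ⟨n, hv, le_rfl, fun z h1 h2 => by omega⟩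

/-- The parent function read off an inversion set. -/
noncomputable def parentI (n : ℕ) (I : ℕ → ℕ → ℕ) (v : ℕ) : ℕ :=
  if h : 1 ≤ v ∧ v < n then Nat.find (exists_parent n I h.2) else 0

lemma parentI_spec {n : ℕ} {I : ℕ → ℕ → ℕ} {v : ℕ} (h : 1 ≤ v) (h' : v < n) :
    v < parentI n I v ∧ parentI n I v ≤ n ∧ DRel n I v (parentI n I v) := by
  unfold parentI
  rw [dif_pos ⟨h, h'⟩]
  exact Nat.find_spec (exists_parent n I h')

lemma parentI_min {n : ℕ} {I : ℕ → ℕ → ℕ} {v y : ℕ} (h : 1 ≤ v) (h' : v < n) (hy : v < y)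
    (hyn : y ≤ n) (hD : DRel n I v y) : parentI n I v ≤ y := by
  unfold parentI
  rw [dif_pos ⟨h, h'⟩]
  exact Nat.find_min' (exists_parent n I h') ⟨hy, hyn, hD⟩

/-- If two vertices agree above `z` and one of them is not a descendant of `z`, then
they agree at `z`. -/
lemma agree_of_not_DRel {n : ℕ} {s : ℕ → ℕ} {I : ℕ → ℕ → ℕ} (hT : IsTransitiveInv I)
    (hP : ∀ x y z, 1 ≤ x → x < y → y < z → z ≤ n → I y x = s y ∨ I z x ≤ I z y)
    {x y z : ℕ} (hx : 1 ≤ x) (hy : 1 ≤ y) (hxz : x < z) (hyz : y < z)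
    (hagree : ∀ z', z < z' → z' ≤ n → I z' x = I z' y) (hD : ¬ DRel n I x z) :
    I z x = I z y := by
  unfold DRel at hD
  push Not at hD
  obtain ⟨w, hw, hwn, hne⟩ := hD
  have e := hagree w hw hwn
  rcases lt_or_gt_of_ne hne with h | h
  · have h1 := hT x z w hxz hw
    have h2 := hT y z w hyz hw
    omega
  · have h1 := hP x z w hx hxz hw hwn
    have h2 := hP y z w hy hyz hw hwn
    omega

/-- The tree of an inversion set. -/
noncomputable def ofInv (n : ℕ) (s : ℕ → ℕ) (I : ℕ → ℕ → ℕ) (hT : IsTransitiveInv I)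
    (hP : ∀ x y z, 1 ≤ x → x < y → y < z → z ≤ n → I y x = s y ∨ I z x ≤ I z y)
    (hs : ∀ y x, I y x ≤ s y) : SDecTree n s where
  parent := parentI n I
  idx v := if 1 ≤ v ∧ v < n then I (parentI n I v) v else 0
  parent_gt v h h' := (parentI_spec h h').1
  parent_le v h h' := (parentI_spec h h').2.1
  idx_le v h h' := by rw [if_pos ⟨h, h'⟩]; exact hs _ _
  slot_inj := by
    have aux : ∀ v w, 1 ≤ v → v < w → w < n → parentI n I v = parentI n I w →
        I (parentI n I v) v = I (parentI n I w) w → False := by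
      intro v w hv hvw hwn hp hi
      obtain ⟨a1, a2, a3⟩ := parentI_spec (I := I) hv (by omega : v < n)
      obtain ⟨b1, b2, b3⟩ := parentI_spec (I := I) (by omega : 1 ≤ w) hwn
      have hD : DRel n I v w := by
        have key : ∀ k z, n - z = k → w < z → z ≤ n → I z v = I z w := by
          intro k
          induction k using Nat.strong_induction_on with
          | _ k ih =>
            intro z hk hz hzn
            by_cases hzp : parentI n I w < z
            · rw [a3 z (by omega) hzn, b3 z hzp hzn, hp]
            · by_cases hzp' : z = parentI n I w
              · rw [hzp', ← hi, hp]
              · refine agree_of_not_DRel hT hP hv (by omega) (by omega) hz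
                  (fun z' h1 h2 => ih (n - z') (by omega) z' rfl (by omega) h2) ?_
                intro hD
                have := parentI_min hv (by omega) (by omega) hzn hD
                omega
        exact fun z h1 h2 => key _ z rfl h1 h2
      have := parentI_min hv (by omega) hvw hwn.le hD
      omega
    intro v w hv hvn hw hwn hp hi
    simp only [hv, hvn, hw, hwn, and_self, if_true] at hi
    rcases lt_trichotomy v w with h | h | h
    · exact (aux v w hv h hwn hp hi).elim
    · exact h
    · exact (aux w v hw h hvn hp.symm hi.symm).elim
  parent_out v h := by unfold parentI; rw [dif_neg (by omega)]
  idx_out v h := by rw [if_neg (by omega)]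

section ofInv

variable {I : ℕ → ℕ → ℕ} (hT : IsTransitiveInv I)
    (hP : ∀ x y z, 1 ≤ x → x < y → y < z → z ≤ n → I y x = s y ∨ I z x ≤ I z y)
    (hs : ∀ y x, I y x ≤ s y)

lemma ofInv_DRel {x y : ℕ} (h : (ofInv n s I hT hP hs).Descend x y) : DRel n I x y := by
  obtain ⟨k, hk⟩ : ∃ k, k = n - x := ⟨_, rfl⟩
  induction k using Nat.strong_induction_on generalizing x with
  | _ k ih =>
    rcases h.cases_head with rfl | ⟨h1, h2⟩
    · exact fun z _ _ => rfl
    · obtain ⟨a1, a2, a3⟩ := parentI_spec (I := I) h.range.1 h1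
      have h2' : (ofInv n s I hT hP hs).Descend (parentI n I x) y := h2
      have h3 := ih (n - parentI n I x) (by omega) h2' rfl
      have h4 := h2'.le
      intro z hz hzn
      rw [a3 z (by omega) hzn, h3 z hz hzn]

lemma ofInv_descend {x y : ℕ} (hx : 1 ≤ x) (hxy : x ≤ y) (hy : y ≤ n) (h : DRel n I x y) :
    (ofInv n s I hT hP hs).Descend x y := by
  obtain ⟨k, hk⟩ : ∃ k, k = n - x := ⟨_, rfl⟩
  induction k using Nat.strong_induction_on generalizing x with
  | _ k ih =>
    by_cases hxy' : x = y
    · subst hxy'; exact descend_refl _ hx hy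
    · obtain ⟨a1, a2, a3⟩ := parentI_spec (I := I) hx (by omega : x < n)
      have h1 := parentI_min hx (by omega) (by omega) hy h
      have h2 : (ofInv n s I hT hP hs).Descend x (parentI n I x) :=
        descend_parent (ofInv n s I hT hP hs) hx (by omega)
      refine h2.trans (ih (n - parentI n I x) (by omega) (by omega) h1 ?_ rfl)
      intro z hz hzn
      rw [← a3 z (by omega) hzn, h z hz hzn]

lemma ofInv_inSub {x y j : ℕ} (hy : 1 ≤ y) (h : (ofInv n s I hT hP hs).InSub y j x) :
    I y x = j := by
  obtain ⟨c, h1, h2, h3⟩ := h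
  have h4 := lt_n_of_parent _ (by rw [h2]; exact hy)
  have h5 : parentI n I c = y := h2
  have h6 : (if 1 ≤ c ∧ c < n then I (parentI n I c) c else 0) = j := h3
  rw [if_pos h4, h5] at h6
  have h7 := parentI_spec (I := I) h4.1 h4.2
  rw [ofInv_DRel hT hP hs h1 y (by omega) (by omega), h6]

lemma ofInv_card {x y : ℕ} (hx : 1 ≤ x) (hxy : x < y) (hy : y ≤ n) :
    (ofInv n s I hT hP hs).card y x = I y x := by
  by_cases hD : DRel n I x y
  · obtain ⟨j, hj⟩ := (ofInv_descend hT hP hs hx hxy.le hy hD).exists_inSub hxy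
    rw [hj.card_eq, ofInv_inSub hT hP hs (by omega) hj]
  · rcases (ofInv n s I hT hP hs).trichotomy hx hxy hy with h | h | h
    · exact (hD (ofInv_DRel hT hP hs h)).elim
    · rw [card_left h]
      obtain ⟨w, j1, j2, hj, h1, h2, hw, huw, hvw⟩ := h.data
      have e1 := ofInv_inSub hT hP hs hw h1
      have e2 := ofInv_inSub hT hP hs hw h2
      have := hT x y w hxy hvw
      omega
    · rw [card_right h hxy]
      obtain ⟨w, j1, j2, hj, h1, h2, hw, huw, hvw⟩ := h.data
      have e1 := ofInv_inSub hT hP hs hw h1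
      have e2 := ofInv_inSub hT hP hs hw h2
      have h3 := (h1.descend hw).1.range
      have := hP x y w hx hxy huw (by omega)
      omega

end ofInv

/-- Membership in `T^a ∖ 0` (for an ascent `(a,b)`) in terms of cardinalities. -/
def MRel (T : SDecTree n s) (a x : ℕ) : Prop := x = a ∨ (0 < T.card a x ∧ T.card a x < s a)

/-- The inversion set of the rotation. -/
noncomputable def rotInv (T : SDecTree n s) (a b : ℕ) : ℕ → ℕ → ℕ := fun y x =>
  T.card y x + if y = b ∧ T.MRel a x then 1 else 0

section asc

variable {T : SDecTree n s} {a b : ℕ}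

lemma TreeAscent.card_lt (h : T.TreeAscent a b) : T.card b a < s b := by
  obtain ⟨h1, h2, h3, ⟨i, hi, hi'⟩, h5, h6⟩ := h
  rwa [hi'.card_eq]

lemma TreeAscent.desc (h : T.TreeAscent a b) : T.Descend a b := by
  obtain ⟨h1, h2, h3, ⟨i, hi, hi'⟩, h5, h6⟩ := h
  exact (hi'.descend (by omega)).1

lemma MRel.desc {x : ℕ} (h : T.TreeAscent a b) (hM : T.MRel a x) : T.Descend x a := by
  rcases hM with rfl | ⟨h1, h2⟩
  · exact T.descend_refl h.1 (by have := h.2.1; have := h.2.2.1; omega)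
  · exact ((inSub_of_card h1 h2).descend h.1).1

lemma TreeAscent.left_lt (h : T.TreeAscent a b) {x : ℕ} (hx : T.LeftOf a x) (hxb : x < b) :
    T.card b a < T.card b x := by
  have hlt := h.card_lt
  have hd := h.desc
  obtain ⟨w, j1, j2, hj, h1, h2, hw, huw, hvw⟩ := hx.data
  rcases lt_trichotomy w b with hwb | hwb | hwb
  · have e := h.2.2.2.2.1 w j1 huw hwb h1
    have := h2.le_s hw
    omega
  · subst hwb
    rw [h1.card_eq, h2.card_eq]; exact hj
  · have : T.LeftOf b x := ⟨w, j1, j2, hj, h1.up hd hwb, h2⟩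
    rw [card_right this hxb]
    exact hlt

lemma TreeAscent.factX (h : T.TreeAscent a b) {x : ℕ} (hx : 0 < T.card a x) (hM : ¬ T.MRel a x) :
    T.card b a < T.card b x := by
  have hr : 1 ≤ x ∧ x < a ∧ a ≤ n := by
    by_contra hr
    rw [T.card_out hr] at hx; omega
  have hab := h.2.1
  have hle := T.card_le a x
  have heq : T.card a x = s a := by
    by_contra hne
    exact hM (Or.inr ⟨hx, by omega⟩)
  rcases T.trichotomy hr.1 hr.2.1 hr.2.2 with h1 | h1 | h1
  · exfalso
    obtain ⟨j, hj⟩ := h1.exists_inSub hr.2.1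
    have := hj.card_eq
    have hj' : j = s a := by omega
    subst hj'
    exact h.2.2.2.2.2 (by omega) x hj
  · rw [card_left h1] at hx; omega
  · exact h.left_lt h1 (by omega)

lemma rotInv_trans (h : T.TreeAscent a b) : IsTransitiveInv (rotInv T a b) := by
  intro x y z hxy hyz
  have hab := h.2.1
  have hd := h.desc
  have hTr := T.card_trans x y z hxy hyz
  unfold rotInv
  by_cases hz : z = b
  · subst hz
    have hyz' : y ≠ z := by omega
    simp only [hyz', false_and, if_false, add_zero, true_and]
    rcases hTr with h0 | h0
    · exact Or.inl h0
    by_cases hy0 : T.card y x = 0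
    · exact Or.inl hy0
    right
    by_cases hMy : T.MRel a y
    · rw [if_pos hMy]
      have hdy := hMy.desc h
      have e1 := card_desc hdy hab
      have hpos : 0 < T.card a x := by
        rcases hMy with rfl | ⟨g1, g2⟩
        · omega
        · have hya : y < a := ((inSub_of_card g1 g2).descend h.1).2
          have := T.card_trans x y a hxy hya
          omega
      by_cases hMx : T.MRel a x
      · rw [if_pos hMx]; omega
      · have := h.factX hpos hMx
        omega
    · rw [if_neg hMy]; omega
  · simp only [hz, false_and, if_false, add_zero]
    by_cases hMx : y = b ∧ T.MRel a x
    · right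
      obtain ⟨rfl, hMx⟩ := hMx
      rw [card_desc ((hMx.desc h).trans hd) hyz]
    · rw [if_neg hMx]; simpa using hTr

lemma rotInv_planar (h : T.TreeAscent a b) : ∀ x y z, 1 ≤ x → x < y → y < z → z ≤ n →
    rotInv T a b y x = s y ∨ rotInv T a b z x ≤ rotInv T a b z y := by
  intro x y z hx hxy hyz hzn
  have hab := h.2.1
  have hd := h.desc
  have hPl := T.card_planar hx hxy hyz
  unfold rotInv
  by_cases hz : z = b
  · subst hz
    have hyz' : y ≠ z := by omega
    simp only [hyz', false_and, if_false, add_zero, true_and]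
    rcases hPl with h0 | h0
    · exact Or.inl h0
    by_cases hMx : T.MRel a x
    · rw [if_pos hMx]
      have hdx := hMx.desc h
      have e1 := card_desc hdx hab
      by_cases hMy : T.MRel a y
      · rw [if_pos hMy]; omega
      · rw [if_neg hMy, e1]
        rcases lt_trichotomy y a with hya | hya | hya
        · have hxa : x ≠ a := by omega
          rcases hMx with g | ⟨g1, g2⟩
          · omega
          rcases T.card_planar hx hxy hya with g | g
          · exact Or.inl g
          · right
            have := h.factX (x := y) (by omega) hMy
            omega
        · exact (hMy (Or.inl hya)).elim
        · rcases T.trichotomy h.1 hya (by omega) with g | g | g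
          · obtain ⟨j, hj⟩ := g.exists_inSub hya
            left
            rw [card_desc hdx hya, hj.card_eq]
            exact h.2.2.2.2.1 y j hya hyz hj
          · right
            have := h.left_lt g hyz
            omega
          · left
            rw [card_desc hdx hya, card_right g hya]
    · rw [if_neg hMx]; right; omega
  · simp only [hz, false_and, if_false, add_zero]
    by_cases hMx : y = b ∧ T.MRel a x
    · right
      obtain ⟨rfl, hMx⟩ := hMx
      rw [card_desc ((hMx.desc h).trans hd) hyz]
    · rw [if_neg hMx]; simpa using hPl

lemma rotInv_le (h : T.TreeAscent a b) (y x : ℕ) : rotInv T a b y x ≤ s y := by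
  unfold rotInv
  split_ifs with hc
  · obtain ⟨rfl, hM⟩ := hc
    rw [card_desc (hM.desc h) h.2.1]
    exact h.card_lt
  · exact T.card_le y x

lemma rotInv_out (h : T.TreeAscent a b) {y x : ℕ} (hr : ¬ (1 ≤ x ∧ x < y ∧ y ≤ n)) :
    rotInv T a b y x = 0 := by
  unfold rotInv
  rw [T.card_out hr, if_neg]
  rintro ⟨rfl, hM⟩
  have h1 := (hM.desc h).range
  have h2 := (hM.desc h).le
  have h3 := h.2.1
  have h4 := h.2.2.1
  omega

lemma addInv_self (h : T.TreeAscent a b) : addInv s T.card b a b a = T.card b a + 1 := by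
  have := h.card_lt
  unfold addInv
  simp only [and_self, if_true]
  omega

lemma card_le_addInv (y x : ℕ) : T.card y x ≤ addInv s T.card b a y x := by
  have := T.card_le y x
  unfold addInv
  split_ifs
  · omega
  · exact le_rfl

lemma rotInv_least (h : T.TreeAscent a b) {J : ℕ → ℕ → ℕ} (hJ : IsTransitiveInv J)
    (hle : ∀ y x, T.card y x ≤ J y x) (hba : T.card b a + 1 ≤ J b a) (y x : ℕ) :
    rotInv T a b y x ≤ J y x := by
  unfold rotInv
  split_ifs with hc
  · obtain ⟨rfl, hM⟩ := hc
    have e := card_desc (hM.desc h) h.2.1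
    rcases hM with rfl | ⟨g1, g2⟩
    · exact hba
    · have hxa : x < a := ((inSub_of_card g1 g2).descend h.1).2
      have h1 := hJ x a y hxa h.2.1
      have h2 := hle a x
      omega
  · exact hle y x

lemma tcInv_eq (h : T.TreeAscent a b) (y x : ℕ) :
    tcInv (addInv s T.card b a) y x = rotInv T a b y x := by
  apply le_antisymm
  · apply Nat.sInf_le
    refine ⟨rotInv T a b, rotInv_trans h, fun y' x' => ?_, rfl⟩
    unfold addInv rotInv
    split_ifs with h1 h2 h3
    · omega
    · exact (h2 ⟨h1.1, Or.inl h1.2⟩).elim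
    · omega
    · omega
  · apply le_csInf
    · exact ⟨_, rotInv T a b, rotInv_trans h, fun y' x' => by
        unfold addInv rotInv
        split_ifs with h1 h2 h3
        · omega
        · exact (h2 ⟨h1.1, Or.inl h1.2⟩).elim
        · omega
        · omega, rfl⟩
    · rintro m ⟨J, hJ, hle, rfl⟩
      refine rotInv_least h hJ (fun y x => (card_le_addInv y x).trans (hle y x)) ?_ y x
      rw [← addInv_self h]
      exact hle b a

lemma isRotation_iff (h : T.TreeAscent a b) (Z : SDecTree n s) :
    IsRotation T Z a b ↔ ∀ y x, Z.card y x = rotInv T a b y x := by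
  constructor
  · intro hZ y x
    by_cases hr : 1 ≤ x ∧ x < y ∧ y ≤ n
    · rw [hZ.2 y x hr.1 hr.2.1 hr.2.2, tcInv_eq h]
    · rw [Z.card_out hr, rotInv_out h hr]
  · intro hZ
    exact ⟨h, fun y x _ _ _ => by rw [hZ, tcInv_eq h]⟩

lemma exists_rotation (h : T.TreeAscent a b) :
    ∃ R : SDecTree n s, ∀ y x, R.card y x = rotInv T a b y x := by
  refine ⟨ofInv n s (rotInv T a b) (rotInv_trans h) (rotInv_planar h) (rotInv_le h), ?_⟩
  intro y x
  by_cases hr : 1 ≤ x ∧ x < y ∧ y ≤ n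
  · exact ofInv_card _ _ _ hr.1 hr.2.1 hr.2.2
  · rw [card_out _ hr, rotInv_out h hr]

lemma rotInv_self : rotInv T a b b a = T.card b a + 1 := by
  unfold rotInv
  rw [if_pos ⟨rfl, Or.inl rfl⟩]

/-- Elements between `T` and its rotation. -/
lemma between_rotation (h : T.TreeAscent a b) {Z U : SDecTree n s}
    (hZ : ∀ y x, Z.card y x = rotInv T a b y x) (h1 : wle T U) (h2 : wle U Z) :
    U = T ∨ U = Z := by
  by_cases hba : T.card b a + 1 ≤ U.card b a
  · right
    refine wle_antisymm h2 fun y x => ?_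
    rw [hZ]
    exact rotInv_least h U.card_trans h1 hba y x
  · left
    refine wle_antisymm (fun y x => ?_) h1
    have g := h2 y x
    rw [hZ] at g
    unfold rotInv at g
    split_ifs at g with hc
    · obtain ⟨rfl, hM⟩ := hc
      have e := card_desc (hM.desc h) h.2.1
      have hr := (hM.desc h).range
      rcases hM with rfl | ⟨g1, g2⟩
      · omega
      · have hxa : x < a := ((inSub_of_card g1 g2).descend h.1).2
        have p1 := U.card_planar hr.1 hxa h.2.1
        have p2 := h1 a x
        have p3 := h2 a x
        rw [hZ] at p3
        unfold rotInv at p3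
        have hne : a ≠ y := by have := h.2.1; omega
        rw [if_neg (by tauto)] at p3
        omega
    · exact g

lemma wcov_rotation {Z : SDecTree n s} (hR : IsRotation T Z a b) : wcov T Z := by
  have h := hR.1
  have hZ := (isRotation_iff h Z).1 hR
  refine ⟨⟨fun y x => ?_, fun hle => ?_⟩, ?_⟩
  · rw [hZ]; unfold rotInv; omega
  · have := hle b a
    rw [hZ, rotInv_self] at this
    omega
  · intro U hU1 hU2
    rcases between_rotation h hZ hU1.1 hU2.1 with rfl | rfl
    · exact hU1.2 hU1.1
    · exact hU2.2 hU2.1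

end asc

end SDecTree

/-- the diamond case.  If `(a,b)` is still a tree ascent of `Q` and `(c,d)`
is still a tree ascent of `Z`, then `[T, Z ∨ Q] = {T, Z, Q, Z ∨ Q}` is a diamond, whose
two maximal chains `T ⋖ Z ⋖ Z ∨ Q` and `T ⋖ Q ⋖ Z ∨ Q` are obtained by rotations along
ascents with smaller elements `a, c` and `c, a` respectively. -/
theorem diamond_interval (n : ℕ) (s : ℕ → ℕ) (T Z Q W : SDecTree n s)
    (a b c d : ℕ) (hac : a < c)
    (hZ : SDecTree.IsRotation T Z a b) (hQ : SDecTree.IsRotation T Q c d)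
    (hQa : Q.TreeAscent a b) (hZc : Z.TreeAscent c d)
    (hW : SDecTree.IsJoin Z Q W) :
    {U : SDecTree n s | SDecTree.wle T U ∧ SDecTree.wle U W} = {T, Z, Q, W} ∧
    (T ≠ Z ∧ T ≠ Q ∧ T ≠ W ∧ Z ≠ Q ∧ Z ≠ W ∧ Q ≠ W) ∧
    SDecTree.wcov T Z ∧ SDecTree.wcov T Q ∧
    SDecTree.wcov Z W ∧ SDecTree.wcov Q W ∧
    SDecTree.IsRotation Z W c d ∧ SDecTree.IsRotation Q W a b := by
  have hA := hZ.1
  have hC := hQ.1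
  have eZ := (SDecTree.isRotation_iff hA Z).1 hZ
  have eQ := (SDecTree.isRotation_iff hC Q).1 hQ
  have hab := hA.2.1
  have hcd := hC.2.1
  have fZ : ∀ y x, Z.card y x = T.card y x + if y = b ∧ T.MRel a x then 1 else 0 := eZ
  have fQ : ∀ y x, Q.card y x = T.card y x + if y = d ∧ T.MRel c x then 1 else 0 := eQ
  have hMa : ¬ T.MRel a c := by
    intro hM
    have := (hM.desc hA).le
    omega
  have hZdc : Z.card d c = T.card d c := by rw [fZ, if_neg (by tauto)]; rfl
  -- the added sets are disjoint
  have hdisj : ∀ x, b = d → T.MRel a x → T.MRel c x → False := by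
    rintro x rfl h1 h2
    have hd := h1.desc hA
    have e := SDecTree.card_desc hd hac
    have hle := hd.le
    rcases h2 with h2 | ⟨g1, g2⟩
    · omega
    · rw [e] at g1 g2
      have := hA.2.2.2.2.1 c _ hac hcd (SDecTree.inSub_of_card g1 g2)
      omega
  have hQba : Q.card b a = T.card b a := by
    rw [fQ, if_neg]
    · rfl
    · rintro ⟨h1, h2⟩
      exact hdisj a h1 (Or.inl rfl) h2
  -- the sets moved are unchanged
  have hMQ : ∀ x, Q.MRel a x ↔ T.MRel a x := by
    intro x
    unfold SDecTree.MRel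
    have : a ≠ d := by omega
    rw [fQ, if_neg (by tauto)]
    rfl
  have hMZ : ∀ x, Z.MRel c x ↔ T.MRel c x := by
    intro x
    by_cases hc : c = b ∧ T.MRel a x
    · obtain ⟨rfl, hM⟩ := hc
      have e := SDecTree.card_desc (hM.desc hA) hab
      have hMca : T.MRel c a := by
        by_contra hno
        have e1 := SDecTree.card_desc hA.desc hcd
        have e2 := SDecTree.card_desc hQa.desc hcd
        rw [fQ, fQ, if_neg (by tauto), if_pos ⟨rfl, Or.inl rfl⟩] at e2
        omega
      have hne : a ≠ c := by omega
      have hZca : Z.card c a = T.card c a + 1 := by rw [fZ, if_pos ⟨rfl, Or.inl rfl⟩]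
      have hMZca : Z.MRel c a := by
        by_contra hno
        have := hZc.factX (x := a) (by omega) hno
        have hdc : d ≠ c := by omega
        rw [fZ, fZ, if_neg (by tauto), if_neg (by tauto)] at this
        have e1 := SDecTree.card_desc hA.desc hcd
        omega
      have h1 : 0 < T.card c a ∧ T.card c a < s c := hMca.resolve_left hne
      have h2 : 0 < Z.card c a ∧ Z.card c a < s c := hMZca.resolve_left hne
      have h3 : Z.card c x = T.card c x + 1 := by rw [fZ, if_pos ⟨rfl, hM⟩]
      constructor
      · intro _; right; omega
      · intro _; right; omega
    · unfold SDecTree.MRel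
      rw [fZ, if_neg hc]
      rfl
  obtain ⟨R, eR⟩ := SDecTree.exists_rotation hZc
  have fR : ∀ y x, R.card y x = T.card y x + (if y = b ∧ T.MRel a x then 1 else 0)
      + if y = d ∧ T.MRel c x then 1 else 0 := by
    intro y x
    rw [eR]
    unfold SDecTree.rotInv
    rw [fZ, hMZ]
  have hRW : W = R := by
    apply SDecTree.wle_antisymm
    · apply hW.2.2
      · intro y x; rw [fR, fZ]; omega
      · intro y x; rw [fR, fQ]; omega
    · intro y x
      have g1 := hW.1 y x
      have g2 := hW.2.1 y x
      rw [fZ] at g1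
      rw [fQ] at g2
      rw [fR]
      by_cases h1 : y = b ∧ T.MRel a x
      · by_cases h2 : y = d ∧ T.MRel c x
        · exact (hdisj x (by omega) h1.2 h2.2).elim
        · rw [if_neg h2]; exact g1
      · rw [if_neg h1]; exact g2
  subst hRW
  have hZW : SDecTree.IsRotation Z W c d := (SDecTree.isRotation_iff hZc W).2 eR
  have eW : ∀ y x, W.card y x = SDecTree.rotInv Q a b y x := by
    intro y x
    unfold SDecTree.rotInv
    rw [fR, fQ, hMQ]
    omega
  have hQW : SDecTree.IsRotation Q W a b := (SDecTree.isRotation_iff hQa W).2 eW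
  have zba : Z.card b a = T.card b a + 1 := by rw [eZ, SDecTree.rotInv_self]
  have qdc : Q.card d c = T.card d c + 1 := by rw [eQ, SDecTree.rotInv_self]
  have wba : W.card b a = T.card b a + 1 := by rw [eW, SDecTree.rotInv_self, hQba]
  have wdc : W.card d c = T.card d c + 1 := by rw [eR, SDecTree.rotInv_self, hZdc]
  have lTZ : SDecTree.wle T Z := fun y x => by rw [fZ]; omega
  have lTQ : SDecTree.wle T Q := fun y x => by rw [fQ]; omega
  have lTW : SDecTree.wle T W := fun y x => (lTZ y x).trans (hW.1 y x)
  refine ⟨?_, ⟨?_, ?_, ?_, ?_, ?_, ?_⟩, SDecTree.wcov_rotation hZ, SDecTree.wcov_rotation hQ,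
    SDecTree.wcov_rotation hZW, SDecTree.wcov_rotation hQW, hZW, hQW⟩
  · ext U
    simp only [Set.mem_ofPred_eq, Set.mem_insert_iff, Set.mem_singleton_iff]
    constructor
    · rintro ⟨h1, h2⟩
      by_cases hb : T.card b a + 1 ≤ U.card b a
      · have hZU : SDecTree.wle Z U := fun y x => by
          rw [eZ]; exact SDecTree.rotInv_least hA U.card_trans h1 hb y x
        rcases SDecTree.between_rotation hZc eR hZU h2 with h | h <;> simp [h]
      by_cases hd : T.card d c + 1 ≤ U.card d c
      · have hQU : SDecTree.wle Q U := fun y x => by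
          rw [eQ]; exact SDecTree.rotInv_least hC U.card_trans h1 hd y x
        rcases SDecTree.between_rotation hQa eW hQU h2 with h | h <;> simp [h]
      left
      -- at row `b`, over `T^a ∖ 0`
      have key : ∀ a b, T.TreeAscent a b → ¬ (T.card b a + 1 ≤ U.card b a) →
          (∀ x, U.card a x = T.card a x) → ∀ x, T.MRel a x → U.card b x ≤ T.card b x := by
        intro a b hA hb hrow x hM
        have e := SDecTree.card_desc (hM.desc hA) hA.2.1
        have hr := (hM.desc hA).range
        rcases hM with rfl | ⟨g1, g2⟩
        · omega
        · have hxa : x < a := ((SDecTree.inSub_of_card g1 g2).descend hA.1).2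
          have p1 := U.card_planar hr.1 hxa hA.2.1
          have := hrow x
          omega
      have hrowa : ∀ x, U.card a x = T.card a x := by
        intro x
        have p1 := h1 a x
        have p2 := h2 a x
        have n1 : a ≠ b := by omega
        have n2 : a ≠ d := by omega
        rw [fR, if_neg (by tauto), if_neg (by tauto)] at p2
        omega
      have kA := key a b hA hb hrowa
      have hrowc : ∀ x, U.card c x = T.card c x := by
        intro x
        have p1 := h1 c x
        have p2 := h2 c x
        have n2 : c ≠ d := by omega
        rw [fR, if_neg (c := c = d ∧ T.MRel c x) (by tauto)] at p2
        split_ifs at p2 with hc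
        · obtain ⟨rfl, hM⟩ := hc
          have := kA x hM
          omega
        · omega
      have kC := key c d hC hd hrowc
      refine SDecTree.wle_antisymm (fun y x => ?_) h1
      have p := h2 y x
      rw [fR] at p
      split_ifs at p with q1 q2 q2
      · rw [q1.1]; exact kA x q1.2
      · rw [q1.1]; exact kA x q1.2
      · rw [q2.1]; exact kC x q2.2
      · exact p
    · have rfl' : ∀ V : SDecTree n s, SDecTree.wle V V := fun V y x => le_rfl
      rintro (rfl | rfl | rfl | rfl)
      · exact ⟨rfl' _, lTW⟩
      · exact ⟨lTZ, hW.1⟩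
      · exact ⟨lTQ, hW.2.1⟩
      · exact ⟨lTW, rfl' _⟩
  · intro h; rw [h] at zba; omega
  · intro h; rw [h] at qdc; omega
  · intro h; rw [h] at wba; omega
  · intro h; rw [h] at hZdc; omega
  · intro h; rw [h] at hZdc; omega
  · intro h; rw [h] at hQba; omega
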